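/- For all positive integers n and m, there exists a polynomial P with integer coefficients of degree 2m-1 such that L_1 · L_3 · L_5 ⋯ L_{2m+1} · (∑_{k=1}^{n} F_{2k}^{2m+1}) = (F_{2n+1} - 1)^2 · P(F_{2n+1}). (Melham's conjecture, the main theorem of the paper.) -/

import Mathlib

/-- The Lucas numbers: `L 0 = 2`, `L 1 = 1`, `L (n+2) = L (n+1) + L n`. -/
def lucas : ℕ → ℕ
  | 0 => 2
  | 1 => 1
  | n + 2 => lucas (n + 1) + lucas n

open Polynomial in
/-- `y * V j (y^2) = u^(2j+1) - v^(2j+1)` whenever `u - v = y`, `u * v = y^2 + 1`. -/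
noncomputable def melhamV : ℕ → Polynomial ℤ
  | 0 => 1
  | 1 => 4 * X + 3
  | j + 2 => (3 * X + 2) * melhamV (j + 1) - (1 + X) ^ 2 * melhamV j

open Polynomial in
/-- `X^(d+2) - 1 - (d+2) (X-1) = (X-1)^2 * A d`. -/
noncomputable def melhamA : ℕ → Polynomial ℤ
  | 0 => 1
  | d + 1 => melhamA d * X + C ((d : ℤ) + 2)

namespace Melham
open Polynomial

lemma lucas_step (j : ℕ) :
    (lucas (2 * (j + 2) + 1) : ℤ) = 3 * lucas (2 * (j + 1) + 1) - lucas (2 * j + 1) := by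
  have h1 : lucas (2 * (j + 2) + 1) = lucas (2 * j + 4) + lucas (2 * j + 3) := rfl
  have h2 : lucas (2 * j + 4) = lucas (2 * j + 3) + lucas (2 * j + 2) := rfl
  have h3 : lucas (2 * j + 3) = lucas (2 * j + 2) + lucas (2 * j + 1) := rfl
  have h4 : lucas (2 * (j + 1) + 1) = lucas (2 * j + 3) := rfl
  omega

lemma lucas_pos (n : ℕ) : 0 < lucas n ∧ 0 < lucas (n + 1) := by
  induction n with
  | zero => decide
  | succ n ih =>
    refine ⟨ih.2, ?_⟩
    have : lucas (n + 1 + 1) = lucas (n + 1) + lucas n := rfl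
    omega

lemma V_coeff_zero (j : ℕ) : (melhamV j).coeff 0 = 2 * j + 1 := by
  induction j using Nat.twoStepInduction with
  | zero => simp [melhamV]
  | one => simp [melhamV]
  | more j h1 h2 =>
    rw [coeff_zero_eq_eval_zero] at *
    simp [melhamV, h1, h2]
    ring

lemma V_deg (j : ℕ) : (melhamV j).natDegree ≤ j ∧
    (melhamV j).coeff j = lucas (2 * j + 1) := by
  induction j using Nat.twoStepInduction with
  | zero => simp [melhamV, lucas]
  | one =>
    constructor
    · simp only [melhamV]; compute_degree
    · have : (4 * X + 3 : ℤ[X]) = C 4 * X + C 3 := by simp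
      simp [melhamV, this, lucas, coeff_C, -eq_intCast]
  | more j h1 h2 =>
    have d1 : (3 * X + 2 : ℤ[X]).natDegree ≤ 1 := by compute_degree
    have d2 : ((1 + X) ^ 2 : ℤ[X]).natDegree ≤ 2 := by compute_degree
    have c1 : (3 * X + 2 : ℤ[X]).coeff 1 = 3 := by compute_degree!
    have c2 : ((1 + X) ^ 2 : ℤ[X]).coeff 2 = 1 := by compute_degree!
    constructor
    · simp only [melhamV]
      refine (natDegree_sub_le _ _).trans (max_le ?_ ?_)
      · exact natDegree_mul_le.trans (by omega)
      · exact natDegree_mul_le.trans (by omega)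
    · simp only [melhamV]
      rw [lucas_step, coeff_sub, show j + 2 = 1 + (j + 1) by ring,
        coeff_mul_add_eq_of_natDegree_le d1 h2.1, show 1 + (j + 1) = 2 + j by ring,
        coeff_mul_add_eq_of_natDegree_le d2 h1.1, c1, c2, h1.2, h2.2]
      ring

lemma V_eval (u v : ℤ) (h : u * v = (u - v) ^ 2 + 1) (j : ℕ) :
    (u - v) * (melhamV j).eval ((u - v) ^ 2) = u ^ (2 * j + 1) - v ^ (2 * j + 1) := by
  induction j using Nat.twoStepInduction with
  | zero => simp [melhamV]
  | one =>
    simp [melhamV]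
    linear_combination (-3 * (u - v)) * h
  | more j h1 h2 =>
    have e : (u - v) * (melhamV (j + 2)).eval ((u - v) ^ 2) =
        (3 * (u - v) ^ 2 + 2) * ((u - v) * (melhamV (j + 1)).eval ((u - v) ^ 2)) -
        (1 + (u - v) ^ 2) ^ 2 * ((u - v) * (melhamV j).eval ((u - v) ^ 2)) := by
      simp [melhamV]; ring
    rw [e, h1, h2]
    have e1 : 3 * (u - v) ^ 2 + 2 = u ^ 2 + v ^ 2 := by linear_combination (-2) * h
    have e2 : 1 + (u - v) ^ 2 = u * v := by linear_combination -h
    rw [e1, e2]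
    ring

lemma V_sum (y : ℤ) (j : ℕ) : y * (melhamV j).eval (y ^ 2) =
    ∑ i ∈ Finset.range (j + 1), (melhamV j).coeff i * y ^ (2 * i + 1) := by
  rw [eval_eq_sum_range' (Nat.lt_succ_of_le (V_deg j).1), Finset.mul_sum]
  refine Finset.sum_congr rfl fun i _ => ?_
  ring

lemma A_spec (d : ℕ) (x : ℤ) :
    x ^ (d + 2) - 1 - (d + 2) * (x - 1) = (x - 1) ^ 2 * (melhamA d).eval x := by
  induction d with
  | zero => simp [melhamA]; ring
  | succ d ih =>
    simp [melhamA]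
    linear_combination x * ih

lemma A_deg (d : ℕ) : (melhamA d).Monic ∧ (melhamA d).natDegree = d := by
  induction d with
  | zero => simp [melhamA]
  | succ d ih =>
    have h1 : (melhamA d * X).Monic := ih.1.mul monic_X
    have h2 : (melhamA d * X).natDegree = d + 1 := by
      rw [ih.1.natDegree_mul monic_X, ih.2, natDegree_X]
    simp only [melhamA]
    constructor
    · apply h1.add_of_left
      refine degree_C_le.trans_lt ?_
      rw [degree_eq_natDegree h1.ne_zero, h2]
      exact_mod_cast Nat.succ_pos d
    · rw [natDegree_add_C, h2]

lemma fib_rel (n : ℕ) : (Nat.fib (2 * n + 3) : ℤ) * Nat.fib (2 * n + 1) =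
    ((Nat.fib (2 * n + 3) : ℤ) - Nat.fib (2 * n + 1)) ^ 2 + 1 := by
  induction n with
  | zero => norm_num [Nat.fib]
  | succ n ih =>
    have e1 : Nat.fib (2 * (n + 1) + 3) = Nat.fib (2 * n + 3) + Nat.fib (2 * n + 4) :=
      Nat.fib_add_two
    have e2 : Nat.fib (2 * n + 4) = Nat.fib (2 * n + 2) + Nat.fib (2 * n + 3) :=
      Nat.fib_add_two
    have e3 : Nat.fib (2 * n + 3) = Nat.fib (2 * n + 1) + Nat.fib (2 * n + 2) :=
      Nat.fib_add_two
    rw [show 2 * (n + 1) + 1 = 2 * n + 3 by ring, e1, e2]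
    rw [e3] at ih ⊢
    push_cast at ih ⊢
    linear_combination ih

/-- The sum of odd powers. -/
def S (m n : ℕ) : ℤ := ∑ k ∈ Finset.Icc 1 n, (Nat.fib (2 * k) : ℤ) ^ (2 * m + 1)

lemma S_rel (m n : ℕ) :
    ∑ i ∈ Finset.range (m + 1), (melhamV m).coeff i * S i n =
      (Nat.fib (2 * n + 1) : ℤ) ^ (2 * m + 1) - 1 := by
  induction n with
  | zero => simp [S]
  | succ n ih =>
    have hS : ∀ i, S i (n + 1) = S i n + (Nat.fib (2 * (n + 1)) : ℤ) ^ (2 * i + 1) := by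
      intro i
      simp only [S]
      rw [Finset.sum_Icc_succ_top (by omega)]
    simp only [hS, mul_add, Finset.sum_add_distrib]
    have e3 : Nat.fib (2 * n + 3) = Nat.fib (2 * n + 1) + Nat.fib (2 * n + 2) :=
      Nat.fib_add_two
    have e4 : (Nat.fib (2 * n + 2) : ℤ) = Nat.fib (2 * n + 3) - Nat.fib (2 * n + 1) := by
      rw [e3]; push_cast; ring
    have key := V_eval _ _ (fib_rel n) m
    rw [V_sum, ← e4] at key
    rw [ih]
    simp only [mul_one]
    rw [key, show 2 * n + 2 + 1 = 2 * n + 3 by ring]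
    ring

lemma S_zero (n : ℕ) : S 0 n = (Nat.fib (2 * n + 1) : ℤ) - 1 := by
  have := S_rel 0 n
  simpa [melhamV] using this

/-- Product of odd-indexed Lucas numbers. -/
def Pi (a : ℕ) : ℤ := ∏ j ∈ Finset.range a, (lucas (2 * j + 1) : ℤ)

/-- Uniform version: the polynomial does not depend on `n`. -/
theorem uniform (t : ℕ) : ∃ P : ℤ[X], P.natDegree = 2 * t + 1 ∧
    ∀ n : ℕ, Pi (t + 2) * S (t + 1) n =
      ((Nat.fib (2 * n + 1) : ℤ) - 1) ^ 2 * P.eval (Nat.fib (2 * n + 1) : ℤ) := by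
  induction t using Nat.strong_induction_on with
  | _ t ih =>
  have ih' : ∀ i, ∃ P : ℤ[X], i < t → (P.natDegree = 2 * i + 1 ∧
    ∀ n : ℕ, Pi (i + 2) * S (i + 1) n =
      ((Nat.fib (2 * n + 1) : ℤ) - 1) ^ 2 * P.eval (Nat.fib (2 * n + 1) : ℤ)) := by
    intro i
    by_cases h : i < t
    · obtain ⟨P, hP⟩ := ih i h
      exact ⟨P, fun _ => hP⟩
    · exact ⟨0, fun h' => absurd h' h⟩
  choose p hp using ih'
  have hQ : ∀ i, ∃ q : ℤ, i < t → Pi (t + 1) = Pi (i + 2) * q := by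
    intro i
    by_cases h : i < t
    · have : Pi (i + 2) ∣ Pi (t + 1) := by
        apply Finset.prod_dvd_prod_of_subset
        intro a
        simp only [Finset.mem_range]
        omega
      obtain ⟨q, hq⟩ := this
      exact ⟨q, fun _ => hq⟩
    · exact ⟨0, fun h' => absurd h' h⟩
  choose q hq using hQ
  have hPi : Pi (t + 1) ≠ 0 := by
    apply Finset.prod_ne_zero_iff.2
    intro j _
    exact_mod_cast (lucas_pos (2 * j + 1)).1.ne'
  refine ⟨C (Pi (t + 1)) * melhamA (2 * t + 1) -
    ∑ i ∈ Finset.range t, C ((melhamV (t + 1)).coeff (i + 1) * q i) * p i, ?_, ?_⟩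
  · have hA : (C (Pi (t + 1)) * melhamA (2 * t + 1)).natDegree = 2 * t + 1 := by
      rw [natDegree_C_mul hPi, (A_deg _).2]
    have hB : (∑ i ∈ Finset.range t,
        C ((melhamV (t + 1)).coeff (i + 1) * q i) * p i).natDegree ≤ 2 * t := by
      apply natDegree_sum_le_of_forall_le
      intro i hi
      have hi' := Finset.mem_range.1 hi
      refine (natDegree_C_mul_le _ _).trans ?_
      rw [(hp i hi').1]
      omega
    rw [natDegree_sub_eq_left_of_natDegree_lt (by omega), hA]
  · intro n
    have h := S_rel (t + 1) n
    rw [Finset.sum_range_succ, Finset.sum_range_succ', V_coeff_zero, S_zero,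
      (V_deg (t + 1)).2] at h
    have hA := A_spec (2 * t + 1) (Nat.fib (2 * n + 1) : ℤ)
    have hP2 : Pi (t + 2) = Pi (t + 1) * lucas (2 * (t + 1) + 1) := by
      simp only [Pi]
      rw [Finset.prod_range_succ]
    have hsum : Pi (t + 1) * ∑ i ∈ Finset.range t, (melhamV (t + 1)).coeff (i + 1) * S (i + 1) n =
        ((Nat.fib (2 * n + 1) : ℤ) - 1) ^ 2 * ∑ i ∈ Finset.range t,
          ((melhamV (t + 1)).coeff (i + 1) * q i) * (p i).eval (Nat.fib (2 * n + 1) : ℤ) := by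
      rw [Finset.mul_sum, Finset.mul_sum]
      refine Finset.sum_congr rfl fun i hi => ?_
      have hi' := Finset.mem_range.1 hi
      rw [hq i hi']
      linear_combination (q i * (melhamV (t + 1)).coeff (i + 1)) * (hp i hi').2 n
    rw [eval_sub, eval_mul, eval_C, eval_finsetSum]
    simp only [eval_mul (p := C _), eval_C]
    rw [hP2]
    push_cast at h hA
    rw [show 2 * (t + 1) + 1 = 2 * t + 1 + 2 by ring] at *
    linear_combination (Pi (t + 1)) * h - hsum + Pi (t + 1) * hA

end Melham

/-- **Melham's conjecture.** For all positive integers `n, m`, the number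
`L 1 * L 3 * ⋯ * L (2m+1) * ∑_{k=1}^{n} F (2k) ^ (2m+1)` equals
`(F (2n+1) - 1)^2 * P (F (2n+1))` for some integer polynomial `P` of degree `2m-1`. -/
theorem melham_conjecture (n m : ℕ) (hn : 0 < n) (hm : 0 < m) :
    ∃ P : Polynomial ℤ, P.natDegree = 2 * m - 1 ∧
      ((∏ j ∈ Finset.range (m + 1), (lucas (2 * j + 1) : ℤ)) *
        ∑ k ∈ Finset.Icc 1 n, (Nat.fib (2 * k) : ℤ) ^ (2 * m + 1)) =
      ((Nat.fib (2 * n + 1) : ℤ) - 1) ^ 2 * P.eval (Nat.fib (2 * n + 1) : ℤ) := by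
  obtain ⟨t, rfl⟩ : ∃ t, m = t + 1 := ⟨m - 1, by omega⟩
  obtain ⟨P, hd, hP⟩ := Melham.uniform t
  exact ⟨P, by omega, hP n⟩
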